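/- Let K be a field of characteristic zero and A_1,...,A_n finite-dimensional K-vector spaces with dim A_j ≥ r for all j. Then the generators of the homogeneous ideal of σ_r(PA_1* × ... × PA_n*) are given by the modules generating the ideal of the subspace variety Sub_{r,...,r} together with the modules inherited from the modules generating the ideal of σ_r(P^{r-1} × ... × P^{r-1}) (n factors). -/

import Mathlib

/-!
Statement 10: for `dim A_j ≥ r`, the ideal of `σ_r(PA₁* × ... × PA_n*)` is generated by
the generators of the ideal of the subspace variety `Sub_{r,...,r}` (the `(r+1)×(r+1)`
minors of the one-factor-versus-the-rest flattenings) together with the modules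
inherited from the generators of the ideal of the basic case
`σ_r(P^{r-1} × ... × P^{r-1})`.  The inherited modules are realized as the pullbacks of
the elements of the ideal of the basic case under all tensor products of linear maps.
-/

open MvPolynomial

variable {n : ℕ}

/-- Index set of the natural basis of `A₁ ⊗ ... ⊗ A_n`, `dim A_j = a j`. -/
abbrev Ind (a : Fin n → ℕ) := ∀ j, Fin (a j)

/-- `T ∈ A₁* ⊗ ... ⊗ A_n*` is a sum of at most `r` decomposable tensors. -/
def RankLE {K : Type} [Field K] {a : Fin n → ℕ} (r : ℕ) (T : Ind a → K) : Prop :=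
  ∃ v : Fin r → ∀ j, Fin (a j) → K, ∀ w, T w = ∑ i, ∏ j, v i j (w j)

/-- The homogeneous ideal of (the affine cone over) `σ_r(PA₁* × ... × PA_n*)`. -/
noncomputable def secantIdeal (K : Type) [Field K] (a : Fin n → ℕ) (r : ℕ) :
    Ideal (MvPolynomial (Ind a) K) :=
  ⨅ (T : Ind a → K) (_ : RankLE r T), RingHom.ker (MvPolynomial.eval T)

/-- The `m×m` minors of the one-factor-versus-the-rest flattenings
`A_{j₀}* ⊗ (A₁⊗...⊗Â_{j₀}⊗...⊗A_n)*`; these generate the ideal of the subspace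
variety `Sub_{m-1,...,m-1}`. -/
noncomputable def oneVsRestMinors (K : Type) [Field K] (a : Fin n → ℕ) (m : ℕ) :
    Set (MvPolynomial (Ind a) K) :=
  { f | ∃ (j₀ : Fin n) (ρ : Fin m → Fin (a j₀)) (γ : Fin m → Ind a),
      f = Matrix.det (Matrix.of fun i j : Fin m =>
        (X (Function.update (γ j) j₀ (ρ i)) : MvPolynomial (Ind a) K)) }

/-- Pullback of a polynomial on `K^r ⊗ ... ⊗ K^r` to a polynomial on
`A₁* ⊗ ... ⊗ A_n*` along the tensor product of the linear maps `α j : A_j* → (K^r)*`;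
the images of a module of polynomials under all such pullbacks span the module
inherited from it. -/
noncomputable def inheritMap (K : Type) [Field K] (a : Fin n → ℕ) (r : ℕ)
    (α : ∀ j, Fin r → Fin (a j) → K) :
    MvPolynomial (∀ _ : Fin n, Fin r) K →ₐ[K] MvPolynomial (Ind a) K :=
  aeval (fun v => ∑ w : Ind a, (∏ j, α j (v j) (w j)) • (X w : MvPolynomial (Ind a) K))

open scoped Matrix

/-- If `rel` has no chain of `r + 1` elements in `S`, then `S` can be coloured with `r` colours
so that related elements get different colours. -/
theorem exists_chain_coloring {α : Type*} (rel : α → α → Prop) [IsTrans α rel] (r : ℕ) :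
    ∀ S : Finset α,
      (¬ ∃ f : Fin (r + 1) → α, (∀ i, f i ∈ S) ∧ ∀ i j, i < j → rel (f i) (f j)) →
      ∃ c : α → ℕ, (∀ x ∈ S, c x < r) ∧ ∀ x ∈ S, ∀ y ∈ S, c x = c y → ¬ rel x y := by
  classical
  induction r with
  | zero =>
    intro S hS
    have hempty : ∀ x, x ∉ S := fun x hx =>
      hS ⟨fun _ => x, fun _ => hx, fun i j hij => by omega⟩
    exact ⟨fun _ => 0, fun x hx => (hempty x hx).elim, fun x hx => (hempty x hx).elim⟩
  | succ r ih =>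
    intro S hS
    obtain ⟨c, hc, hc'⟩ := ih (S.filter fun x => ∃ y ∈ S, rel y x) (by
      rintro ⟨f, hf, hlt⟩
      simp only [Finset.mem_filter] at hf
      obtain ⟨y, hy, hy0⟩ := (hf 0).2
      refine hS ⟨Fin.cons y f, fun i => ?_, fun i j hij => ?_⟩
      · cases i using Fin.cases with
        | zero => simpa using hy
        | succ i => simpa using (hf i).1
      · cases j using Fin.cases with
        | zero => exact absurd hij (Fin.not_lt_zero i)
        | succ j =>
          cases i using Fin.cases with
          | zero =>
            rcases Fin.eq_zero_or_eq_succ j with h | ⟨k, h⟩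
            · subst h; simpa using hy0
            · have hj : rel (f 0) (f j) := hlt 0 j (by rw [h]; exact Fin.succ_pos k)
              simpa using _root_.trans hy0 hj
          | succ i => simpa using hlt i j (by simpa using hij))
    refine ⟨fun x => if ∃ y ∈ S, rel y x then c x else r, fun x hx => ?_, ?_⟩
    · by_cases h : ∃ y ∈ S, rel y x
      · have := hc x (by simp [hx, h])
        simp only [h, if_true]; omega
      · simp [h]
    · intro x hx y hy hxy hrel
      have h2 : ∃ z ∈ S, rel z y := ⟨x, hx, hrel⟩
      by_cases h1 : ∃ z ∈ S, rel z x
      · simp only [h1, h2, if_true] at hxy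
        exact hc' x (by simp [hx, h1]) y (by simp [hy, h2]) hxy hrel
      · have := hc y (by simp [hy, h2])
        simp only [h1, h2, if_true, if_false] at hxy
        omega

theorem Finsupp.exists_eq_sum_single {α : Type*} (m : α →₀ ℕ) :
    ∃ (d : ℕ) (s : Fin d → α), m = ∑ k, Finsupp.single (s k) 1 := by
  induction m using Finsupp.induction_linear with
  | zero => exact ⟨0, Fin.elim0, by simp⟩
  | add f g hf hg =>
    obtain ⟨d, s, rfl⟩ := hf
    obtain ⟨e, t, rfl⟩ := hg
    exact ⟨d + e, Fin.append s t, by simp [Fin.sum_univ_add]⟩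
  | single a k => exact ⟨k, fun _ => a, by simp⟩

/-- The `m × m` minors of the generic `p × q` matrix. -/
def genericMinors (K : Type*) [CommRing K] (p q m : ℕ) :
    Set (MvPolynomial (Fin p × Fin q) K) :=
  { f | ∃ (ρ : Fin m → Fin p) (γ : Fin m → Fin q),
      f = Matrix.det (Matrix.of fun i j : Fin m => (X (ρ i, γ j) : MvPolynomial _ K)) }

/-- The number of cells weakly south-east of a given one. -/
def cellWeight {p q : ℕ} (x : Fin p × Fin q) : ℕ := (p - x.1) * (q - x.2)

/-- The strict north-east to south-west order on cells. -/
def AntidiagRel {p q : ℕ} (x y : Fin p × Fin q) : Prop := x.1 < y.1 ∧ y.2 < x.2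

instance {p q : ℕ} : IsTrans (Fin p × Fin q) AntidiagRel :=
  ⟨fun _ _ _ h h' => ⟨h.1.trans h'.1, h'.2.trans h.2⟩⟩

/-- The support of `m` contains no antidiagonal chain of `r + 1` cells. -/
def AntidiagFree {p q : ℕ} (r : ℕ) (m : Fin p × Fin q →₀ ℕ) : Prop :=
  ¬ ∃ f : Fin (r + 1) → Fin p × Fin q,
    (∀ i, f i ∈ m.support) ∧ ∀ i j, i < j → AntidiagRel (f i) (f j)

theorem weight_cellWeight_le {p q : ℕ} (m : Fin p × Fin q →₀ ℕ) :
    Finsupp.weight cellWeight m ≤ Finsupp.degree m * (p * q) := by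
  rw [Finsupp.weight_apply, Finsupp.degree_apply, Finsupp.sum, Finset.sum_mul]
  exact Finset.sum_le_sum fun x _ => Nat.mul_le_mul_left _
    (Nat.mul_le_mul (Nat.sub_le _ _) (Nat.sub_le _ _))

theorem cellWeight_sum_lt_of_antidiag {p q r : ℕ} (f : Fin r → Fin p × Fin q)
    (hf : ∀ i j, i < j → AntidiagRel (f i) (f j)) (σ : Equiv.Perm (Fin r)) (hσ : σ ≠ 1) :
    ∑ i, cellWeight (f i) < ∑ i, cellWeight ((f (σ i)).1, (f i).2) := by
  have hmono : StrictMono fun i => (f i).1 := fun i j h => (hf i j h).1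
  have hanti : StrictAnti fun i => (f i).2 := fun i j h => (hf i j h).2
  have hmono' : StrictMono fun i => q - ((f i).2 : ℕ) := fun i j h => by
    have h1 := (f i).2.2
    have h2 : ((f j).2 : ℕ) < (f i).2 := hanti h
    change q - _ < q - _
    omega
  have hanti' : StrictAnti fun i => p - ((f i).1 : ℕ) := fun i j h => by
    have h1 := (f j).1.2
    have h2 : ((f i).1 : ℕ) < (f j).1 := hmono h
    change p - _ < p - _
    omega
  refine (Antivary.sum_mul_lt_sum_comp_perm_mul_iff (σ := σ)
    (hanti'.antitone.antivary hmono'.monotone)).2 fun h => hσ ?_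
  have hσm : StrictMono σ := by
    intro i j hij
    have h1 := h (hmono' hij)
    by_contra hlt
    rcases (not_lt.1 hlt).eq_or_lt with h2 | h2
    · exact hij.ne' (σ.injective h2)
    · exact absurd (hanti' h2) (not_lt.2 h1)
  ext i
  have : (hσm.orderIsoOfSurjective σ σ.surjective) = OrderIso.refl _ := Subsingleton.elim _ _
  exact congrArg (fun e : Fin r ≃o Fin r => ((e i : Fin r) : ℕ)) this

/-- Modulo the `(r + 1)`-minors, every monomial is a combination of antidiagonal-free ones. -/
theorem monomial_mem_minors_sup_antidiagFree (K : Type*) [Field K] (p q r : ℕ)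
    (m : Fin p × Fin q →₀ ℕ) :
    monomial m (1 : K) ∈ (Ideal.span (genericMinors K p q (r + 1))).restrictScalars K ⊔
      Submodule.span K { f | ∃ m, AntidiagFree r m ∧ f = monomial m (1 : K) } := by
  classical
  generalize hN : Finsupp.degree m * (p * q) - Finsupp.weight cellWeight m = N
  induction N using Nat.strong_induction_on generalizing m with
  | _ N ih =>
    by_cases hm : AntidiagFree r m
    · exact Submodule.mem_sup_right (Submodule.subset_span ⟨m, hm, rfl⟩)
    obtain ⟨f, hf, hlt⟩ := not_not.1 hm
    have hinj : Function.Injective f := by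
      intro i j hij
      by_contra hne
      rcases lt_or_gt_of_ne hne with h | h
      · exact absurd (hlt _ _ h).1 (by rw [hij]; exact lt_irrefl _)
      · exact absurd (hlt _ _ h).1 (by rw [hij]; exact lt_irrefl _)
    have hle : ∑ k, Finsupp.single (f k) 1 ≤ m := by
      intro x
      rw [Finsupp.finsetSum_apply]
      by_cases hx : ∃ k, f k = x
      · obtain ⟨k, rfl⟩ := hx
        rw [Finset.sum_eq_single k (fun j _ hj => by
          rw [Finsupp.single_apply, if_neg fun h => hj (hinj h)]) (by simp)]
        simpa [Nat.one_le_iff_ne_zero] using hf k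
      · rw [Finset.sum_eq_zero fun j _ => by
          rw [Finsupp.single_apply, if_neg fun h => hx ⟨j, h⟩]]
        exact Nat.zero_le _
    obtain ⟨m₀, rfl⟩ := exists_add_of_le hle
    set ms : Equiv.Perm (Fin (r + 1)) → (Fin p × Fin q →₀ ℕ) := fun σ =>
      (∑ k, Finsupp.single ((f (σ k)).1, (f k).2) 1) + m₀ with hms
    have hdet : monomial m₀ (1 : K) * Matrix.det (Matrix.of fun i j : Fin (r + 1) =>
        (X ((f i).1, (f j).2) : MvPolynomial (Fin p × Fin q) K)) =
        ∑ σ : Equiv.Perm (Fin (r + 1)), Equiv.Perm.sign σ • monomial (ms σ) (1 : K) := by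
      rw [Matrix.det_apply, Finset.mul_sum]
      refine Finset.sum_congr rfl fun σ _ => ?_
      rw [mul_smul_comm]
      congr 1
      simp only [Matrix.of_apply, X, hms]
      rw [← monomial_sum_one, monomial_mul, one_mul, add_comm]
    have hone : monomial ((∑ k, Finsupp.single (f k) 1) + m₀) (1 : K) =
        monomial m₀ (1 : K) * Matrix.det (Matrix.of fun i j : Fin (r + 1) =>
          (X ((f i).1, (f j).2) : MvPolynomial (Fin p × Fin q) K)) -
        ∑ σ ∈ Finset.univ.erase (1 : Equiv.Perm (Fin (r + 1))),
          Equiv.Perm.sign σ • monomial (ms σ) (1 : K) := by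
      rw [hdet, ← Finset.add_sum_erase _ (fun σ : Equiv.Perm (Fin (r + 1)) =>
        Equiv.Perm.sign σ • monomial (ms σ) (1 : K)) (Finset.mem_univ 1), add_sub_cancel_right]
      simp [hms]
    rw [hone]
    refine Submodule.sub_mem _ (Submodule.mem_sup_left ?_) (Submodule.sum_mem _ fun σ hσ => ?_)
    · exact Ideal.mul_mem_left _ _ (Ideal.subset_span ⟨fun i => (f i).1, fun i => (f i).2, rfl⟩)
    · have hw := cellWeight_sum_lt_of_antidiag f hlt σ (Finset.ne_of_mem_erase hσ)
      have hmem := ih _ (by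
        have h1 := weight_cellWeight_le (ms σ)
        rw [← hN]
        simp only [hms, map_add, map_sum, Finsupp.weight_single, Finsupp.degree_single,
          one_smul] at h1 ⊢
        omega) (ms σ) rfl
      rcases Int.units_eq_one_or (Equiv.Perm.sign σ) with h | h
      · rw [h, one_smul]; exact hmem
      · rw [h, Units.neg_smul, one_smul]; exact Submodule.neg_mem _ hmem

/-- The number of cells of `m`, with multiplicity, weakly north-west of `y`. -/
noncomputable def cumulative {p q : ℕ} (m : Fin p × Fin q →₀ ℕ) (y : Fin p × Fin q) : ℕ :=
  Finsupp.weight (fun x => if x ≤ y then 1 else 0) m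

theorem sum_cumulative {p q : ℕ} (m : Fin p × Fin q →₀ ℕ) :
    ∑ y, cumulative m y = Finsupp.weight cellWeight m := by
  simp only [cumulative, Finsupp.weight_apply, Finsupp.sum]
  rw [Finset.sum_comm]
  refine Finset.sum_congr rfl fun x _ => ?_
  rw [← Finset.smul_sum]
  congr 1
  rw [← Finset.sum_filter, Finset.sum_const, smul_eq_mul, mul_one,
    show Finset.univ.filter (x ≤ ·) = Finset.Ici x by ext; simp, Finset.card_Ici_prod]
  simp [cellWeight]

theorem cumulative_injective {p q : ℕ} {m m' : Fin p × Fin q →₀ ℕ}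
    (h : ∀ y, cumulative m y = cumulative m' y) : m = m' := by
  classical
  have key : ∀ (m : Fin p × Fin q →₀ ℕ) y, cumulative m y = m y + ∑ x with x < y, m x := by
    intro m y
    rw [cumulative, Finsupp.weight_eq_sum]
    simp only [smul_eq_mul, mul_ite, mul_one, mul_zero]
    rw [← Finset.sum_filter, show Finset.univ.filter (· ≤ y) =
      insert y (Finset.univ.filter (· < y)) by ext x; simp [le_iff_eq_or_lt],
      Finset.sum_insert (by simp)]
  ext y
  induction y using WellFoundedLT.induction with
  | _ y ih =>
    have h1 := h y
    rw [key, key, Finset.sum_congr rfl fun x hx => ih x (by simpa using hx)] at h1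
    exact Nat.add_right_cancel h1

/-- Exponent of the term of `∏ k, ∑ c, Y (i k, c) Z (c, j k)` selected by a coloring. -/
noncomputable def pairExp {p q r d : ℕ} (s : Fin d → Fin p × Fin q) (c : Fin d → Fin r) :
    Fin p × Fin r ⊕ Fin r × Fin q →₀ ℕ :=
  ∑ k, (Finsupp.single (Sum.inl ((s k).1, c k)) 1 + Finsupp.single (Sum.inr (c k, (s k).2)) 1)

/-- Substitution of the product of two generic matrices for a generic matrix. -/
noncomputable def productSubst (K : Type*) [CommRing K] (p q r : ℕ) :
    MvPolynomial (Fin p × Fin q) K →ₐ[K] MvPolynomial (Fin p × Fin r ⊕ Fin r × Fin q) K :=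
  aeval fun x => ∑ c, X (Sum.inl (x.1, c)) * X (Sum.inr (c, x.2))

theorem productSubst_monomial (K : Type*) [CommRing K] {p q d : ℕ} (r : ℕ)
    (s : Fin d → Fin p × Fin q) :
    productSubst K p q r (monomial (∑ k, Finsupp.single (s k) 1) 1) =
      ∑ c : Fin d → Fin r, monomial (pairExp s c) 1 := by
  classical
  rw [monomial_sum_one, map_prod]
  have : ∀ k, productSubst K p q r (monomial (Finsupp.single (s k) 1) 1) =
      ∑ c, X (Sum.inl ((s k).1, c)) * X (Sum.inr (c, (s k).2)) := fun k => aeval_X _ _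
  simp only [this]
  rw [Finset.prod_univ_sum, Fintype.piFinset_univ]
  refine Finset.sum_congr rfl fun c _ => ?_
  rw [pairExp, monomial_sum_one]
  refine Finset.prod_congr rfl fun k _ => ?_
  rw [X, X, monomial_mul, one_mul]

theorem coeff_productSubst_monomial (K : Type*) [CommRing K] {p q r d : ℕ}
    (s : Fin d → Fin p × Fin q) (M : Fin p × Fin r ⊕ Fin r × Fin q →₀ ℕ) :
    coeff M (productSubst K p q r (monomial (∑ k, Finsupp.single (s k) 1) 1)) =
      ((Finset.univ.filter fun c : Fin d → Fin r => pairExp s c = M).card : K) := by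
  classical
  rw [productSubst_monomial, coeff_sum]
  simp only [coeff_monomial]
  rw [Finset.sum_boole]

theorem sum_weight_eq_of_pairExp_eq {p q r d d' : ℕ} {s : Fin d → Fin p × Fin q}
    {c : Fin d → Fin r} {s' : Fin d' → Fin p × Fin q} {c' : Fin d' → Fin r}
    (h : pairExp s' c' = pairExp s c) (w : Fin p × Fin r ⊕ Fin r × Fin q → ℕ) :
    ∑ k, (w (Sum.inl ((s' k).1, c' k)) + w (Sum.inr (c' k, (s' k).2))) =
      ∑ k, (w (Sum.inl ((s k).1, c k)) + w (Sum.inr (c k, (s k).2))) := by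
  have := congrArg (Finsupp.weight w) h
  simpa [pairExp, Finsupp.weight_single] using this

theorem cumulative_sum_single {p q d r : ℕ} (s : Fin d → Fin p × Fin q) (c : Fin d → Fin r)
    (y : Fin p × Fin q) :
    cumulative (∑ k, Finsupp.single (s k) 1) y =
      ∑ e, (Finset.univ.filter fun k =>
        (c k = e ∧ (s k).1 ≤ y.1) ∧ c k = e ∧ (s k).2 ≤ y.2).card := by
  simp only [cumulative, map_sum, Finsupp.weight_single, one_smul, Finset.card_filter]
  rw [Finset.sum_comm]
  refine Finset.sum_congr rfl fun k _ => ?_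
  rw [Finset.sum_eq_single (c k)]
  · simp [Prod.le_def]
  · intro e _ he
    simp [he.symm]
  · simp

/-- Among all factorizations with given exponents, the cumulative counts are maximal when
every color class is a chain. -/
theorem cumulative_le_of_pairExp_eq {p q r d d' : ℕ} {s : Fin d → Fin p × Fin q}
    {c : Fin d → Fin r} {s' : Fin d' → Fin p × Fin q} {c' : Fin d' → Fin r}
    (h : pairExp s' c' = pairExp s c) (hs : ∀ k l, c k = c l → ¬ AntidiagRel (s k) (s l))
    (y : Fin p × Fin q) :
    cumulative (∑ k, Finsupp.single (s' k) 1) y ≤ cumulative (∑ k, Finsupp.single (s k) 1) y := by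
  classical
  rw [cumulative_sum_single s' c', cumulative_sum_single s c]
  refine Finset.sum_le_sum fun e _ => ?_
  have h1 : (Finset.univ.filter fun k => c' k = e ∧ (s' k).1 ≤ y.1).card =
      (Finset.univ.filter fun k => c k = e ∧ (s k).1 ≤ y.1).card := by
    have := sum_weight_eq_of_pairExp_eq h
      (Sum.elim (fun x => if x.2 = e ∧ x.1 ≤ y.1 then 1 else 0) fun _ => 0)
    simp only [Finset.card_filter]
    simpa [-Finset.sum_boole] using this
  have h2 : (Finset.univ.filter fun k => c' k = e ∧ (s' k).2 ≤ y.2).card =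
      (Finset.univ.filter fun k => c k = e ∧ (s k).2 ≤ y.2).card := by
    have := sum_weight_eq_of_pairExp_eq h
      (Sum.elim (fun _ => 0) fun x => if x.1 = e ∧ x.2 ≤ y.2 then 1 else 0)
    simp only [Finset.card_filter]
    simpa [-Finset.sum_boole] using this
  by_cases hsub : ∀ k, c k = e ∧ (s k).1 ≤ y.1 → c k = e ∧ (s k).2 ≤ y.2
  · calc _ ≤ (Finset.univ.filter fun k => c' k = e ∧ (s' k).1 ≤ y.1).card :=
          Finset.card_le_card fun k hk => by simp at hk ⊢; tauto
      _ = _ := h1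
      _ ≤ _ := Finset.card_le_card fun k hk => by
          have := hsub k
          simp at hk ⊢; tauto
  · calc _ ≤ (Finset.univ.filter fun k => c' k = e ∧ (s' k).2 ≤ y.2).card :=
          Finset.card_le_card fun k hk => by simp at hk ⊢; tauto
      _ = _ := h2
      _ ≤ _ := Finset.card_le_card fun l hl => by
          push Not at hsub
          obtain ⟨k, ⟨hk1, hk2⟩, hk3⟩ := hsub
          have hk4 := hk3 hk1
          simp only [Finset.mem_filter, Finset.mem_univ, true_and] at hl ⊢
          refine ⟨⟨hl.1, ?_⟩, hl⟩
          by_contra hlt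
          exact hs k l (hk1.trans hl.1.symm)
            ⟨hk2.trans_lt (not_le.1 hlt), hl.2.trans_lt hk4⟩

theorem eq_zero_of_productSubst_eq_zero {K : Type*} [Field K] [CharZero K] {p q r : ℕ}
    (g : MvPolynomial (Fin p × Fin q) K) (hg : ∀ m ∈ g.support, AntidiagFree r m)
    (h0 : productSubst K p q r g = 0) : g = 0 := by
  classical
  by_contra hne
  obtain ⟨m₀, hm₀, hmin⟩ := Finset.exists_min_image g.support (Finsupp.weight cellWeight)
    (support_nonempty.2 hne)
  obtain ⟨col, hcol, hcol'⟩ := exists_chain_coloring AntidiagRel r m₀.support (hg m₀ hm₀)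
  obtain ⟨d, s, rfl⟩ := Finsupp.exists_eq_sum_single m₀
  have hmem : ∀ k, s k ∈ (∑ k, Finsupp.single (s k) 1 : Fin p × Fin q →₀ ℕ).support := by
    intro k
    rw [Finsupp.mem_support_iff, Finsupp.finsetSum_apply]
    have := Finset.single_le_sum (f := fun j => (Finsupp.single (s j) 1 : _ →₀ ℕ) (s k))
      (fun _ _ => Nat.zero_le _) (Finset.mem_univ k)
    simp only [Finsupp.single_eq_same] at this
    omega
  set c : Fin d → Fin r := fun k => ⟨col (s k), hcol _ (hmem k)⟩ with hc
  have hs : ∀ k l, c k = c l → ¬ AntidiagRel (s k) (s l) := fun k l hkl =>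
    hcol' _ (hmem k) _ (hmem l) (congrArg Fin.val hkl)
  have hcoeff : coeff (pairExp s c) (productSubst K p q r g) =
      coeff (∑ k, Finsupp.single (s k) 1) g *
        coeff (pairExp s c) (productSubst K p q r (monomial (∑ k, Finsupp.single (s k) 1) 1)) := by
    conv_lhs => rw [g.as_sum, map_sum, coeff_sum]
    rw [Finset.sum_eq_single_of_mem _ hm₀]
    · rw [← mul_one (coeff _ g), ← smul_eq_mul, ← smul_monomial, map_smul, coeff_smul, smul_eq_mul,
        smul_eq_mul, mul_one]
    · intro m hm hmne
      rw [← mul_one (coeff m g), ← smul_eq_mul, ← smul_monomial, map_smul, coeff_smul]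
      obtain ⟨d', s', rfl⟩ := Finsupp.exists_eq_sum_single m
      rw [coeff_productSubst_monomial, Finset.card_eq_zero.2, Nat.cast_zero, smul_zero]
      rw [Finset.filter_eq_empty_iff]
      intro c' _ hc'
      apply hmne
      have hle := cumulative_le_of_pairExp_eq hc' hs
      have hw := hmin _ hm
      rw [← sum_cumulative, ← sum_cumulative] at hw
      refine cumulative_injective fun y => ?_
      exact (Finset.sum_eq_sum_iff_of_le fun y _ => hle y).1
        ((Finset.sum_le_sum fun y _ => hle y).antisymm hw) y (Finset.mem_univ y)
  rw [h0, coeff_zero, coeff_productSubst_monomial] at hcoeff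
  refine mul_ne_zero (mem_support_iff.1 hm₀) ?_ hcoeff.symm
  rw [Nat.cast_ne_zero]
  exact (Finset.card_pos.2 ⟨c, by simp⟩).ne'

theorem det_mul_eq_zero_of_lt {F : Type*} [Field F] {r m : ℕ} (h : r < m)
    (A : Matrix (Fin m) (Fin r) F) (B : Matrix (Fin r) (Fin m) F) : (A * B).det = 0 := by
  by_contra hne
  have h1 := Matrix.rank_of_det_ne_zero hne
  have h2 := (Matrix.rank_mul_le_left A B).trans A.rank_le_width
  rw [h1, Fintype.card_fin] at h2
  omega

/-- The second fundamental theorem for rational points: a polynomial vanishing on the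
products of rational `p × r` and `r × q` matrices lies in the ideal of `(r + 1)`-minors. -/
theorem mem_span_genericMinors {K : Type*} [Field K] [CharZero K] {p q r : ℕ}
    (h : MvPolynomial (Fin p × Fin q) K)
    (hv : ∀ (Y : Matrix (Fin p) (Fin r) ℚ) (Z : Matrix (Fin r) (Fin q) ℚ),
      eval (fun x => (((Y * Z) x.1 x.2 : ℚ) : K)) h = 0) :
    h ∈ Ideal.span (genericMinors K p q (r + 1)) := by
  classical
  have hvan : ∀ f : MvPolynomial (Fin p × Fin q) K,
      (∀ (Y : Matrix (Fin p) (Fin r) ℚ) (Z : Matrix (Fin r) (Fin q) ℚ),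
        eval (fun x => (((Y * Z) x.1 x.2 : ℚ) : K)) f = 0) → productSubst K p q r f = 0 := by
    intro f hf
    refine funext_set (fun _ => Set.range ((↑) : ℚ → K))
      (fun _ => Set.infinite_range_of_injective Rat.cast_injective) fun x hx => ?_
    simp only [Set.mem_pi, Set.mem_univ, true_implies, Set.mem_range] at hx
    choose y hy using hx
    rw [map_zero, ← hf (Matrix.of fun i c => y (Sum.inl (i, c)))
      (Matrix.of fun c j => y (Sum.inr (c, j)))]
    rw [productSubst, ← coe_aeval_eq_eval, RingHom.coe_coe, comp_aeval_apply, ← coe_aeval_eq_eval]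
    have hx : ∀ i : Fin p × Fin q,
        ((((Matrix.of fun i c => y (Sum.inl (i, c))) * Matrix.of fun c j => y (Sum.inr (c, j)))
          i.1 i.2 : ℚ) : K) = ∑ c, x (Sum.inl (i.1, c)) * x (Sum.inr (c, i.2)) := fun i => by
      simp [Matrix.mul_apply, hy]
    simp [hx]
  have hspan : h ∈ (Ideal.span (genericMinors K p q (r + 1))).restrictScalars K ⊔
      Submodule.span K { f | ∃ m, AntidiagFree r m ∧ f = monomial m (1 : K) } := by
    rw [h.as_sum]
    refine Submodule.sum_mem _ fun m _ => ?_
    rw [← mul_one (coeff m h), ← smul_eq_mul, ← smul_monomial]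
    exact Submodule.smul_mem _ _ (monomial_mem_minors_sup_antidiagFree K p q r m)
  obtain ⟨u, hu, g, hg, rfl⟩ := Submodule.mem_sup.1 hspan
  have hu0 : ∀ (Y : Matrix (Fin p) (Fin r) ℚ) (Z : Matrix (Fin r) (Fin q) ℚ),
      eval (fun x => (((Y * Z) x.1 x.2 : ℚ) : K)) u = 0 := by
    intro Y Z
    have : Ideal.span (genericMinors K p q (r + 1)) ≤
        RingHom.ker (eval fun x : Fin p × Fin q => (((Y * Z) x.1 x.2 : ℚ) : K)) := by
      rw [Ideal.span_le]
      rintro _ ⟨ρ, γ, rfl⟩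
      rw [SetLike.mem_coe, RingHom.mem_ker, RingHom.map_det]
      have : (eval fun x : Fin p × Fin q => (((Y * Z) x.1 x.2 : ℚ) : K)).mapMatrix
          (Matrix.of fun i j => X (ρ i, γ j)) =
          ((Y.submatrix ρ id * Z.submatrix id γ).map (Rat.castHom K)) := by
        ext i j
        simp [Matrix.mul_apply]
      rw [this, ← RingHom.mapMatrix_apply, ← RingHom.map_det,
        det_mul_eq_zero_of_lt (Nat.lt_succ_self r), map_zero]
    exact this hu
  have hg0 : g = 0 := by
    refine eq_zero_of_productSubst_eq_zero (r := r) g ?_ (hvan g fun Y Z => ?_)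
    · clear hv hspan
      induction hg using Submodule.span_induction with
      | mem x hx =>
        obtain ⟨m, hm, rfl⟩ := hx
        intro m' hm'
        rwa [Finset.mem_singleton.1 (support_monomial_subset hm')]
      | zero => simp
      | add x y _ _ hx hy =>
        intro m hm
        rcases Finset.mem_union.1 (support_add hm) with h | h
        · exact hx m h
        · exact hy m h
      | smul a x _ hx => exact fun m hm => hx m (support_smul hm)
    · have := hv Y Z
      rwa [map_add, hu0, zero_add] at this
  rwa [hg0, add_zero]

/-- The tensor power `(1, T)^{⊗ d}` of a matrix `T`, in coordinates. -/
def affineTensorPower {R : Type*} [CommSemiring R] {p q : ℕ} (d : ℕ)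
    (T : Matrix (Fin p) (Fin q) R) (s : Fin d → Option (Fin p × Fin q)) : R :=
  ∏ k, (s k).elim 1 fun x => T x.1 x.2

theorem affineTensorPower_dotProduct {R : Type*} [CommRing R] {p q : ℕ} (d : ℕ)
    (S T : Matrix (Fin p) (Fin q) R) :
    affineTensorPower d S ⬝ᵥ affineTensorPower d T = (1 + (S * Tᵀ).trace) ^ d := by
  classical
  have h : 1 + (S * Tᵀ).trace = ∑ o : Option (Fin p × Fin q),
      (o.elim 1 fun x => S x.1 x.2) * (o.elim 1 fun x => T x.1 x.2) := by
    simp [Fintype.sum_option, Matrix.trace, Matrix.mul_apply, Fintype.sum_prod_type]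
  rw [h, ← Fin.prod_const, Finset.prod_univ_sum, Fintype.piFinset_univ]
  simp only [dotProduct, affineTensorPower, ← Finset.prod_mul_distrib]

theorem affineTensorPower_mul_dotProduct {R : Type*} [CommRing R] {p q : ℕ} (d : ℕ)
    (E : Matrix (Fin p) (Fin p) R) (S T : Matrix (Fin p) (Fin q) R) :
    affineTensorPower d (E * S) ⬝ᵥ affineTensorPower d T =
      affineTensorPower d E ⬝ᵥ affineTensorPower d (T * Sᵀ) := by
  rw [affineTensorPower_dotProduct, affineTensorPower_dotProduct, Matrix.transpose_mul,
    Matrix.transpose_transpose, Matrix.mul_assoc]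

theorem exists_dotProduct_projection {F ι : Type*} [Field F] [LinearOrder F]
    [IsStrictOrderedRing F] [Fintype ι] (S : Submodule F (ι → F)) (x : ι → F) :
    ∃ e ∈ S, ∀ w ∈ S, (x - e) ⬝ᵥ w = 0 := by
  let b : LinearMap.BilinForm F (ι → F) := dotProductBilin F F
  have hb : ∀ v w, b v w = v ⬝ᵥ w := fun _ _ => rfl
  have hrefl : b.IsRefl := fun v w h => by rw [hb] at h ⊢; rwa [dotProduct_comm]
  have hcompl : IsCompl S (b.orthogonal S) := by
    rw [LinearMap.BilinForm.isCompl_orthogonal_iff_disjoint hrefl, Submodule.disjoint_def]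
    intro v hv hv'
    exact dotProduct_self_eq_zero.1 (hv' v hv)
  have hx : x ∈ S ⊔ b.orthogonal S := hcompl.sup_eq_top ▸ Submodule.mem_top
  obtain ⟨e, he, y, hy, rfl⟩ := Submodule.mem_sup.1 hx
  refine ⟨e, he, fun w hw => ?_⟩
  rw [add_sub_cancel_left, dotProduct_comm]
  exact hy w hw

/-- A rational combination of endomorphisms of rank at most `r` which acts as the identity
on the tensor powers of all matrices of rank at most `r`. -/
theorem exists_affineTensorPower_identity (p q r d : ℕ) :
    ∃ c : Matrix (Fin p) (Fin r) ℚ × Matrix (Fin r) (Fin p) ℚ →₀ ℚ,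
      ∀ (Y : Matrix (Fin p) (Fin r) ℚ) (Z : Matrix (Fin r) (Fin q) ℚ),
        c.sum (fun B a => a • affineTensorPower d (B.1 * B.2 * (Y * Z))) =
          affineTensorPower d (Y * Z) := by
  obtain ⟨e, he, horth⟩ := exists_dotProduct_projection
    (Submodule.span ℚ (Set.range fun B : Matrix (Fin p) (Fin r) ℚ × Matrix (Fin r) (Fin p) ℚ =>
      affineTensorPower d (B.1 * B.2))) (affineTensorPower d 1)
  obtain ⟨c, rfl⟩ := Finsupp.mem_span_range_iff_exists_finsupp.1 he
  refine ⟨c, fun Y Z => ?_⟩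
  set u := affineTensorPower d (Y * Z) -
    c.sum (fun B a => a • affineTensorPower d (B.1 * B.2 * (Y * Z))) with hu
  have hu0 : ∀ (Y' : Matrix (Fin p) (Fin r) ℚ) (Z' : Matrix (Fin r) (Fin q) ℚ),
      u ⬝ᵥ affineTensorPower d (Y' * Z') = 0 := by
    intro Y' Z'
    have h := horth (affineTensorPower d (Y' * (Z' * (Y * Z)ᵀ)))
      (Submodule.subset_span ⟨(_, _), rfl⟩)
    rw [sub_dotProduct, Finsupp.sum, sum_dotProduct] at h
    rw [hu, sub_dotProduct, Finsupp.sum, sum_dotProduct, ← h]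
    congr 1
    · rw [← Matrix.mul_assoc, ← affineTensorPower_mul_dotProduct, Matrix.one_mul]
    · refine Finset.sum_congr rfl fun B _ => ?_
      rw [smul_dotProduct, smul_dotProduct, ← Matrix.mul_assoc Y',
        ← affineTensorPower_mul_dotProduct]
  have huu : u ⬝ᵥ u = 0 := by
    conv_lhs => rw [hu, dotProduct_sub, ← hu]
    rw [hu0, Finsupp.sum, dotProduct_sum, Finset.sum_eq_zero, sub_zero]
    intro B _
    rw [dotProduct_smul, Matrix.mul_assoc, hu0, smul_zero]
  exact (sub_eq_zero.1 (dotProduct_self_eq_zero.1 huu)).symm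

theorem exists_eval_monomial_eq_affineTensorPower (K : Type*) [CommRing K] {p q d : ℕ}
    (m : Fin p × Fin q →₀ ℕ) (hm : Finsupp.degree m ≤ d) :
    ∃ s, ∀ T : Matrix (Fin p) (Fin q) K,
      eval (fun x => T x.1 x.2) (monomial m 1) = affineTensorPower d T s := by
  obtain ⟨e, s, rfl⟩ := Finsupp.exists_eq_sum_single m
  simp only [map_sum, Finsupp.degree_single, Finset.sum_const, Finset.card_univ,
    Fintype.card_fin, smul_eq_mul, mul_one] at hm
  obtain ⟨t, rfl⟩ := exists_add_of_le hm
  refine ⟨Fin.append (fun k => some (s k)) fun _ => none, fun T => ?_⟩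
  rw [monomial_sum_one, map_prod, affineTensorPower, Fin.prod_univ_add]
  simp [eval_monomial]

/-- Pullback of polynomial functions on matrices along left multiplication by `E`. -/
noncomputable def leftMulSubst {K : Type*} [CommRing K] {p q : ℕ}
    (E : Matrix (Fin p) (Fin p) K) :
    MvPolynomial (Fin p × Fin q) K →ₐ[K] MvPolynomial (Fin p × Fin q) K :=
  aeval fun x => ∑ i, E x.1 i • X (i, x.2)

theorem eval_leftMulSubst {K : Type*} [CommRing K] {p q : ℕ} (E : Matrix (Fin p) (Fin p) K)
    (T : Matrix (Fin p) (Fin q) K) (f : MvPolynomial (Fin p × Fin q) K) :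
    eval (fun x => T x.1 x.2) (leftMulSubst E f) = eval (fun x => (E * T) x.1 x.2) f := by
  rw [leftMulSubst, ← coe_aeval_eq_eval, RingHom.coe_coe, comp_aeval_apply, ← coe_aeval_eq_eval]
  simp [Matrix.mul_apply]

theorem eval_eq_sum_of_forall_monomial {K σ ι : Type*} [CommRing K] (t : Finset ι) (a : ι → K)
    (x : ι → σ → K) (y : σ → K) (f : MvPolynomial σ K)
    (h : ∀ m ∈ f.support,
      eval y (monomial m 1) = ∑ i ∈ t, a i * eval (x i) (monomial m 1)) :
    eval y f = ∑ i ∈ t, a i * eval (x i) f := by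
  simp only [eval_monomial, one_mul, Finsupp.prod] at h
  simp only [eval_eq, Finset.mul_sum]
  rw [Finset.sum_comm]
  refine Finset.sum_congr rfl fun m hm => ?_
  rw [h m hm, Finset.mul_sum]
  exact Finset.sum_congr rfl fun i _ => mul_left_comm _ _ _

theorem affineTensorPower_map {R S : Type*} [CommSemiring R] [CommSemiring S] (φ : R →+* S)
    {p q d : ℕ} (T : Matrix (Fin p) (Fin q) R) (s : Fin d → Option (Fin p × Fin q)) :
    affineTensorPower d (T.map φ) s = φ (affineTensorPower d T s) := by
  rw [affineTensorPower, affineTensorPower, map_prod]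
  refine Finset.prod_congr rfl fun k _ => ?_
  cases s k <;> simp

/-- Modulo the `(r + 1)`-minors, a polynomial on matrices is a combination of its own
pullbacks along left multiplications by matrices of rank at most `r`. -/
theorem mem_minors_sup_leftMulSubst {K : Type*} [Field K] [CharZero K] {p q : ℕ} (r : ℕ)
    (f : MvPolynomial (Fin p × Fin q) K) :
    f ∈ (Ideal.span (genericMinors K p q (r + 1))).restrictScalars K ⊔
      Submodule.span K { g | ∃ (B : Matrix (Fin p) (Fin r) K) (A : Matrix (Fin r) (Fin p) K),
        g = leftMulSubst (B * A) f } := by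
  obtain ⟨d, hd⟩ : ∃ d, f.totalDegree = d := ⟨_, rfl⟩
  obtain ⟨c, hc⟩ := exists_affineTensorPower_identity p q r d
  set φ := Rat.castHom K
  set g := ∑ B ∈ c.support, φ (c B) • leftMulSubst (B.1.map φ * B.2.map φ) f with hg
  have hgmem : g ∈ Submodule.span K
      { g | ∃ (B : Matrix (Fin p) (Fin r) K) (A : Matrix (Fin r) (Fin p) K),
        g = leftMulSubst (B * A) f } := by
    refine Submodule.sum_mem _ fun B _ => Submodule.smul_mem _ _ (Submodule.subset_span ?_)
    exact ⟨B.1.map φ, B.2.map φ, rfl⟩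
  have hfg : f - g ∈ Ideal.span (genericMinors K p q (r + 1)) := by
    refine mem_span_genericMinors _ fun Y Z => ?_
    have key := eval_eq_sum_of_forall_monomial c.support (fun B => φ (c B))
      (fun B x => ((B.1.map φ * B.2.map φ) * (Y * Z).map φ) x.1 x.2)
      (fun x => (Y * Z).map φ x.1 x.2) f (by
        intro m hm
        obtain ⟨s, hs⟩ := exists_eval_monomial_eq_affineTensorPower K (d := d) m
          (by rw [Finsupp.degree_apply, ← hd]; exact le_totalDegree hm)
        have hsum := congrArg φ (congrFun (hc Y Z) s)
        simp only [Finsupp.sum, Finset.sum_apply, Pi.smul_apply, smul_eq_mul, map_sum,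
          map_mul] at hsum
        rw [hs, affineTensorPower_map, ← hsum]
        refine Finset.sum_congr rfl fun B _ => ?_
        rw [hs, ← affineTensorPower_map, Matrix.map_mul (L := B.1 * B.2),
          Matrix.map_mul (L := B.1)])
    change eval (fun x => (Y * Z).map φ x.1 x.2) (f - g) = 0
    rw [map_sub, key, hg, map_sum, sub_eq_zero]
    refine Finset.sum_congr rfl fun B _ => ?_
    rw [smul_eval, eval_leftMulSubst]
  have := Submodule.add_mem_sup
    (S := (Ideal.span (genericMinors K p q (r + 1))).restrictScalars K) hfg hgmem
  rwa [sub_add_cancel] at this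

/-- Pullback of polynomial functions on tensors along a tensor product of linear maps. -/
noncomputable def tensorSubst {K : Type*} [CommRing K] {a b : Fin n → ℕ}
    (α : ∀ j, Matrix (Fin (b j)) (Fin (a j)) K) :
    MvPolynomial (Ind b) K →ₐ[K] MvPolynomial (Ind a) K :=
  aeval fun v => ∑ w : Ind a, (∏ j, α j (v j) (w j)) • X w

theorem tensorSubst_tensorSubst {K : Type*} [CommRing K] {a b c : Fin n → ℕ}
    (α : ∀ j, Matrix (Fin (b j)) (Fin (a j)) K) (β : ∀ j, Matrix (Fin (c j)) (Fin (b j)) K)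
    (f : MvPolynomial (Ind c) K) :
    tensorSubst α (tensorSubst β f) = tensorSubst (fun j => β j * α j) f := by
  classical
  rw [← AlgHom.comp_apply]
  congr 1
  refine algHom_ext fun v => ?_
  simp only [AlgHom.comp_apply, tensorSubst, aeval_X, map_sum, map_smul, Finset.smul_sum,
    smul_smul, ← Finset.prod_mul_distrib]
  rw [Finset.sum_comm]
  refine Finset.sum_congr rfl fun w _ => ?_
  rw [← Finset.sum_smul]
  simp only [Matrix.mul_apply]
  rw [Finset.prod_univ_sum, Fintype.piFinset_univ]

theorem tensorSubst_update_one_X {K : Type*} [CommRing K] {a : Fin n → ℕ} (j₀ : Fin n)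
    (E : Matrix (Fin (a j₀)) (Fin (a j₀)) K) (v : Ind a) :
    tensorSubst (Function.update (fun j => (1 : Matrix (Fin (a j)) (Fin (a j)) K)) j₀ E) (X v) =
      ∑ i, E (v j₀) i • (X (Function.update v j₀ i) : MvPolynomial (Ind a) K) := by
  rw [tensorSubst, aeval_X]
  symm
  refine Fintype.sum_of_injective (Function.update v j₀) (Function.update_injective v j₀) _ _
    (fun w hw => ?_) fun i => ?_
  · obtain ⟨j, hj, hne⟩ : ∃ j, j ≠ j₀ ∧ v j ≠ w j := by
      by_contra! hcon
      refine hw ⟨w j₀, ?_⟩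
      rw [Function.update_eq_iff]
      exact ⟨rfl, hcon⟩
    rw [Finset.prod_eq_zero (Finset.mem_univ j), zero_smul]
    rw [Function.update_of_ne hj, Matrix.one_apply_ne hne]
  · rw [Finset.prod_eq_single j₀ (fun j _ hj => by simp [Function.update_of_ne hj]) (by simp)]
    simp

theorem tensorSubst_one {K : Type*} [CommRing K] {a : Fin n → ℕ} (f : MvPolynomial (Ind a) K) :
    tensorSubst (fun j => (1 : Matrix (Fin (a j)) (Fin (a j)) K)) f = f := by
  conv_rhs => rw [← AlgHom.id_apply (R := K) f]
  congr 1
  refine algHom_ext fun v => ?_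
  rw [tensorSubst, aeval_X, Finset.sum_eq_single v]
  · simp
  · intro w _ hw
    obtain ⟨j, hj⟩ := Function.ne_iff.1 hw
    rw [Finset.prod_eq_zero (Finset.mem_univ j), zero_smul]
    exact Matrix.one_apply_ne hj.symm
  · simp

theorem eval_tensorSubst {K : Type*} [CommRing K] {a b : Fin n → ℕ}
    (α : ∀ j, Matrix (Fin (b j)) (Fin (a j)) K) (T : Ind a → K) (f : MvPolynomial (Ind b) K) :
    eval T (tensorSubst α f) = eval (fun v => ∑ w : Ind a, (∏ j, α j (v j) (w j)) * T w) f := by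
  rw [tensorSubst, ← coe_aeval_eq_eval, RingHom.coe_coe, comp_aeval_apply, ← coe_aeval_eq_eval]
  simp

/-- Multi-indices as pairs of the index in the factor `j₀` and an enumerated index of the rest. -/
theorem exists_equiv_split (a : Fin n → ℕ) (j₀ : Fin n) :
    ∃ (q : ℕ) (e : Ind a ≃ Fin (a j₀) × Fin q), (∀ w, (e w).1 = w j₀) ∧
      ∀ w i, e.symm (i, (e w).2) = Function.update w j₀ i := by
  refine ⟨_, (Equiv.piSplitAt j₀ fun j => Fin (a j)).trans
    (Equiv.prodCongr (Equiv.refl _) (Fintype.equivFin _)), fun w => rfl, fun w i => ?_⟩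
  rw [Equiv.symm_apply_eq]
  ext1
  · simp
  · simp only [Equiv.trans_apply, Equiv.prodCongr_apply, Prod.map_snd,
      EmbeddingLike.apply_eq_iff_eq]
    ext j
    simp [Function.update_of_ne j.2]

/-- Modulo the minors of one flattening, a polynomial on tensors is a combination of its own
pullbacks along endomorphisms of rank at most `r` of the corresponding factor. -/
theorem mem_minors_sup_tensorSubst_update {K : Type} [Field K] [CharZero K] {a : Fin n → ℕ}
    (r : ℕ) (j₀ : Fin n) (f : MvPolynomial (Ind a) K) :
    f ∈ (Ideal.span (oneVsRestMinors K a (r + 1))).restrictScalars K ⊔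
      Submodule.span K { g | ∃ (B : Matrix (Fin (a j₀)) (Fin r) K)
        (A : Matrix (Fin r) (Fin (a j₀)) K), g = tensorSubst
          (Function.update (fun j => (1 : Matrix (Fin (a j)) (Fin (a j)) K)) j₀ (B * A)) f } := by
  obtain ⟨q, e, he₁, he₂⟩ := exists_equiv_split a j₀
  have hsubst : ∀ (E : Matrix (Fin (a j₀)) (Fin (a j₀)) K) (g : MvPolynomial _ K),
      rename e.symm (leftMulSubst E g) = tensorSubst
        (Function.update (fun j => (1 : Matrix (Fin (a j)) (Fin (a j)) K)) j₀ E)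
        (rename e.symm g) := by
    intro E g
    rw [← AlgHom.comp_apply, ← AlgHom.comp_apply]
    congr 1
    refine algHom_ext fun x => ?_
    obtain ⟨v, rfl⟩ := e.surjective x
    rw [AlgHom.comp_apply, AlgHom.comp_apply, rename_X, e.symm_apply_apply,
      tensorSubst_update_one_X, leftMulSubst, aeval_X, map_sum]
    refine Finset.sum_congr rfl fun i _ => ?_
    rw [map_smul, rename_X, he₁, he₂]
  have hback : rename e.symm (rename e f) = f := by
    rw [rename_rename, Equiv.symm_comp_self, rename_id_apply]
  obtain ⟨u, hu, g, hg, hug⟩ := Submodule.mem_sup.1 (mem_minors_sup_leftMulSubst r (rename e f))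
  refine Submodule.mem_sup.2 ⟨rename e.symm u, ?_, rename e.symm g, ?_,
    by rw [← map_add, hug, hback]⟩
  · have hle : Ideal.span (genericMinors K (a j₀) q (r + 1)) ≤
        (Ideal.span (oneVsRestMinors K a (r + 1))).comap (rename (R := K) e.symm) := by
      rw [Ideal.span_le]
      rintro _ ⟨ρ, γ, rfl⟩
      refine Ideal.subset_span ⟨j₀, ρ, fun j => e.symm (ρ 0, γ j), ?_⟩
      rw [AlgHom.map_det]
      congr 1
      ext1 i j
      simp [← he₂]
    exact hle hu
  · have hle : Submodule.span K { g | ∃ (B : Matrix (Fin (a j₀)) (Fin r) K)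
        (A : Matrix (Fin r) (Fin (a j₀)) K), g = leftMulSubst (B * A) (rename e f) } ≤
        (Submodule.span K { g | ∃ (B : Matrix (Fin (a j₀)) (Fin r) K)
          (A : Matrix (Fin r) (Fin (a j₀)) K), g = tensorSubst (Function.update
            (fun j => (1 : Matrix (Fin (a j)) (Fin (a j)) K)) j₀ (B * A)) f }).comap
          (rename (R := K) e.symm).toLinearMap := by
      rw [Submodule.span_le]
      rintro _ ⟨B, A, rfl⟩
      refine Submodule.subset_span ⟨B, A, ?_⟩
      rw [AlgHom.toLinearMap_apply, hsubst, hback]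
    exact hle hg

/-- Modulo the minors, a polynomial on tensors is a combination of its own pullbacks along
tensor products of endomorphisms, those of the factors in `s` having rank at most `r`. -/
theorem mem_minors_sup_tensorSubst {K : Type} [Field K] [CharZero K] {a : Fin n → ℕ}
    (r : ℕ) (f : MvPolynomial (Ind a) K) (s : Finset (Fin n)) :
    f ∈ (Ideal.span (oneVsRestMinors K a (r + 1))).restrictScalars K ⊔
      Submodule.span K { g | ∃ E : ∀ j, Matrix (Fin (a j)) (Fin (a j)) K,
        (∀ j ∈ s, ∃ (B : Matrix (Fin (a j)) (Fin r) K) (A : Matrix (Fin r) (Fin (a j)) K),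
          E j = B * A) ∧ g = tensorSubst E f } := by
  induction s using Finset.induction_on with
  | empty =>
    exact Submodule.mem_sup_right (Submodule.subset_span ⟨fun _ => 1, by simp,
      (tensorSubst_one f).symm⟩)
  | insert j₀ s hj₀ ih =>
    refine SetLike.le_def.1 (sup_le le_sup_left (Submodule.span_le.2 ?_)) ih
    rintro _ ⟨E, hE, rfl⟩
    refine SetLike.le_def.1
      (sup_le le_sup_left ((Submodule.span_mono ?_).trans le_sup_right))
      (mem_minors_sup_tensorSubst_update r j₀ (tensorSubst E f))
    rintro _ ⟨B, A, rfl⟩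
    refine ⟨_, fun j hj => ?_, tensorSubst_tensorSubst _ _ f⟩
    rcases Finset.mem_insert.1 hj with rfl | hj
    · exact ⟨E j * B, A, by rw [Function.update_self, Matrix.mul_assoc]⟩
    · have hne : j ≠ j₀ := fun h => hj₀ (h ▸ hj)
      obtain ⟨B', A', h⟩ := hE j hj
      exact ⟨B', A', by rw [Function.update_of_ne hne, Matrix.mul_one, h]⟩

theorem mem_secantIdeal {K : Type} [Field K] {a : Fin n → ℕ} {r : ℕ}
    {f : MvPolynomial (Ind a) K} :
    f ∈ secantIdeal K a r ↔ ∀ T : Ind a → K, RankLE r T → eval T f = 0 := by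
  simp [secantIdeal, RingHom.mem_ker]

theorem RankLE.tensorMap {K : Type} [Field K] {a b : Fin n → ℕ} {r : ℕ}
    (α : ∀ j, Matrix (Fin (b j)) (Fin (a j)) K) {T : Ind a → K} (hT : RankLE r T) :
    RankLE r fun v : Ind b => ∑ w : Ind a, (∏ j, α j (v j) (w j)) * T w := by
  classical
  obtain ⟨x, hx⟩ := hT
  refine ⟨fun i j => (α j).mulVec (x i j), fun v => ?_⟩
  simp only [hx, Matrix.mulVec, dotProduct, Finset.mul_sum, Finset.prod_univ_sum,
    Fintype.piFinset_univ, ← Finset.prod_mul_distrib]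
  exact Finset.sum_comm

theorem tensorSubst_mem_secantIdeal {K : Type} [Field K] {a b : Fin n → ℕ} {r : ℕ}
    (α : ∀ j, Matrix (Fin (b j)) (Fin (a j)) K) {f : MvPolynomial (Ind b) K}
    (hf : f ∈ secantIdeal K b r) : tensorSubst α f ∈ secantIdeal K a r := by
  rw [mem_secantIdeal] at hf ⊢
  intro T hT
  rw [eval_tensorSubst]
  exact hf _ (hT.tensorMap α)

theorem oneVsRestMinors_subset_secantIdeal (K : Type) [Field K] (a : Fin n → ℕ) (r : ℕ) :
    oneVsRestMinors K a (r + 1) ⊆ secantIdeal K a r := by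
  rintro _ ⟨j₀, ρ, γ, rfl⟩
  rw [SetLike.mem_coe, mem_secantIdeal]
  rintro T ⟨x, hx⟩
  rw [RingHom.map_det]
  convert det_mul_eq_zero_of_lt (Nat.lt_succ_self r)
    (Matrix.of fun i k => x k j₀ (ρ i))
    (Matrix.of fun k i => ∏ j ∈ Finset.univ.erase j₀, x k j (γ i j)) using 2
  ext i j
  simp only [RingHom.mapMatrix_apply, Matrix.map_apply, Matrix.of_apply, eval_X, hx,
    Matrix.mul_apply]
  refine Finset.sum_congr rfl fun k _ => ?_
  rw [← Finset.mul_prod_erase _ _ (Finset.mem_univ j₀), Function.update_self]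
  congr 1
  refine Finset.prod_congr rfl fun l hl => ?_
  rw [Function.update_of_ne (Finset.ne_of_mem_erase hl)]

/-- **Proposition (Landsberg–Weyman).** Let `dim A_j = a j ≥ r`.  The ideal of
`σ_r(PA₁* × ... × PA_n*)` is generated by the generators of the ideal of
`Sub_{r,...,r}` (the `(r+1)×(r+1)` minors of the one-versus-rest flattenings) together
with the modules inherited from the ideal of `σ_r(P^{r-1} × ... × P^{r-1})`
(`n` factors). -/
theorem secant_ideal_generators_inherited (K : Type) [Field K] [CharZero K]
    (n r : ℕ) (a : Fin n → ℕ) (ha : ∀ j, r ≤ a j) :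
    secantIdeal K a r =
      Ideal.span
        (oneVsRestMinors K a (r + 1) ∪
          { f | ∃ (α : ∀ j, Fin r → Fin (a j) → K)
              (g : MvPolynomial (∀ _ : Fin n, Fin r) K),
              g ∈ secantIdeal K (fun _ => r) r ∧ f = inheritMap K a r α g }) := by
  refine le_antisymm (fun f hf => ?_) (Ideal.span_le.2 (Set.union_subset
    (oneVsRestMinors_subset_secantIdeal K a r) ?_))
  · refine SetLike.le_def.1 (sup_le (c := (Ideal.span _).restrictScalars K)
      (fun _ h => Ideal.span_mono Set.subset_union_left h)
      (Submodule.span_le.2 ?_))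
      (mem_minors_sup_tensorSubst r f Finset.univ)
    rintro _ ⟨E, hE, rfl⟩
    choose B A hBA using fun j => hE j (Finset.mem_univ j)
    refine Ideal.subset_span (Or.inr ⟨A, tensorSubst (a := fun _ => r) B f,
      tensorSubst_mem_secantIdeal (a := fun _ => r) B hf, ?_⟩)
    rw [funext hBA]
    exact (tensorSubst_tensorSubst (b := fun _ => r) A B f).symm
  · rintro _ ⟨α, g, hg, rfl⟩
    exact tensorSubst_mem_secantIdeal (b := fun _ => r) α hg
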